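/- Let γ be a skew shape and let s ≥ t ≥ 2 be integers with (s, t) ∈ LR(γ). Then either (s, t−1, 1) ∈ LR(γ), or in every LR filling of γ of weight (s, t) all t entries equal to 2 occur in a single row of γ. -/

import Mathlib

open scoped Classical

namespace SylowBranching

/-- The cells of the Young diagram of `f` (rows indexed by the first coordinate,
starting from `0`; `f i` is the length of row `i`). -/
def cellsOf (f : ℕ → ℕ) : Set (ℕ × ℕ) := {p | p.2 < f p.1}

/-- `f : ℕ → ℕ` is a partition if it is weakly decreasing with finitely many
nonzero parts.  Its parts are `f 0 ≥ f 1 ≥ ⋯`, and its largest part is `f 0`. -/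
def IsPartition (f : ℕ → ℕ) : Prop :=
  Antitone f ∧ ∃ N, ∀ i, N ≤ i → f i = 0

/-- The size `|f|` of a partition: the number of cells of its Young diagram. -/
noncomputable def psize (f : ℕ → ℕ) : ℕ := (cellsOf f).ncard

/-- `P(n)`: the set of partitions of `n`. -/
def Pset (n : ℕ) : Set (ℕ → ℕ) := {f | IsPartition f ∧ psize f = n}

/-- The conjugate (transpose) partition `f'`. -/
noncomputable def conj (f : ℕ → ℕ) : ℕ → ℕ := fun j => Set.ncard {i | j < f i}

/-- `A° = A ∪ A'`: the closure of a set of partitions under conjugation. -/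
noncomputable def conjClosure (A : Set (ℕ → ℕ)) : Set (ℕ → ℕ) := A ∪ conj '' A

/-- `B_n(t)`: partitions of `n` with largest part at most `t` and at most `t` parts. -/
noncomputable def Bset (n t : ℕ) : Set (ℕ → ℕ) :=
  {f ∈ Pset n | f 0 ≤ t ∧ conj f 0 ≤ t}

/-- The cells of the skew shape `l / m`. -/
def skewCells (l m : ℕ → ℕ) : Set (ℕ × ℕ) :=
  {p | m p.1 ≤ p.2 ∧ p.2 < l p.1}

/-- `d` is read before (or at the same time as) `c` in the reading order of a
filling: right-to-left along rows, rows from top to bottom. -/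
def readBefore (d c : ℕ × ℕ) : Prop :=
  d.1 < c.1 ∨ (d.1 = c.1 ∧ c.2 ≤ d.2)

/-- A Littlewood–Richardson filling of the cell set `γ` of weight `ν`:
all entries are positive; for every `j ≥ 1` there are exactly `ν (j-1)` entries
equal to `j` (i.e. the number of `j`s is the `j`-th part of `ν`); entries weakly
increase along rows and strictly increase down columns; and every initial
segment of the reading word (right-to-left along rows, top to bottom) contains
at least as many entries equal to `j` as entries equal to `j+1`, for all `j ≥ 1`. -/
structure IsLRFilling (γ : Set (ℕ × ℕ)) (ν : ℕ → ℕ) (T : ℕ × ℕ → ℕ) : Prop where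
  pos : ∀ c ∈ γ, 1 ≤ T c
  weight : ∀ j : ℕ, 1 ≤ j → Set.ncard {c ∈ γ | T c = j} = ν (j - 1)
  row_weak : ∀ i j j', (i, j) ∈ γ → (i, j') ∈ γ → j ≤ j' → T (i, j) ≤ T (i, j')
  col_strict : ∀ i i' j, (i, j) ∈ γ → (i', j) ∈ γ → i < i' → T (i, j) < T (i', j)
  lattice : ∀ c ∈ γ, ∀ j : ℕ, 1 ≤ j →
    Set.ncard {d ∈ γ | T d = j + 1 ∧ readBefore d c} ≤
      Set.ncard {d ∈ γ | T d = j ∧ readBefore d c}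

/-- `LR(γ)`: the set of all weights of LR fillings of `γ`. -/
def LRset (γ : Set (ℕ × ℕ)) : Set (ℕ → ℕ) := {ν | ∃ T, IsLRFilling γ ν T}

/-- The Littlewood–Richardson coefficient `c^l_{m ν}`: the number of LR fillings
of the skew shape `l / m` of weight `ν` (zero unless `m ⊆ l`); fillings are
normalised to vanish off the skew shape so that they can be counted. -/
noncomputable def LRcoeff (l m ν : ℕ → ℕ) : ℕ :=
  Set.ncard {T : ℕ × ℕ → ℕ |
    (∀ i, m i ≤ l i) ∧ (∀ c, c ∉ skewCells l m → T c = 0) ∧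
      IsLRFilling (skewCells l m) ν T}

/-- The `⋆` operation on sets of partitions:
`A ⋆ B = {λ : c^λ_{μν} > 0 for some μ ∈ A, ν ∈ B}`. -/
def starOp (A B : Set (ℕ → ℕ)) : Set (ℕ → ℕ) :=
  {l | IsPartition l ∧ ∃ μ ∈ A, ∃ ν ∈ B, 0 < LRcoeff l μ ν}

/-- The partition with the given (weakly decreasing) list of parts. -/
def ofList (L : List ℕ) : ℕ → ℕ := fun i => L.getD i 0

/-- The hook partition `(a, 1^b)`. -/
def hookP (a b : ℕ) : ℕ → ℕ := ofList (a :: List.replicate b 1)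

/-- The partition `(a, μ)` obtained by prepending a first part `a` to `μ`. -/
def consPart (a : ℕ) (μ : ℕ → ℕ) : ℕ → ℕ := fun i => if i = 0 then a else μ (i - 1)

/-- `γ` coincides, up to planar translation, with the Young diagram of `ν`. -/
def TranslateOf (γ : Set (ℕ × ℕ)) (ν : ℕ → ℕ) : Prop :=
  ∃ a b : ℕ, γ = (fun p : ℕ × ℕ => (p.1 + a, p.2 + b)) '' cellsOf ν

/-- `γ` coincides, up to planar translation, with the 180°-rotation of the
Young diagram of `ν`. -/
def RotationOf (γ : Set (ℕ × ℕ)) (ν : ℕ → ℕ) : Prop :=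
  ∃ a b : ℕ, (∀ p ∈ cellsOf ν, p.1 ≤ a ∧ p.2 ≤ b) ∧
    γ = (fun p : ℕ × ℕ => (a - p.1, b - p.2)) '' cellsOf ν

/-- Iterated Littlewood–Richardson coefficients `c^l_{μ^1, …, μ^r}`:
`c^l_{μ} = δ_{l μ}`, and the coefficient for a longer list is obtained by
summing, over partitions `g` of the total size of the remaining factors, the
product of the iterated coefficient of `g` with `c^l_{g μ}`. -/
noncomputable def iterLR : List (ℕ → ℕ) → (ℕ → ℕ) → ℕ
  | [], l => if l = (fun _ => 0 : ℕ → ℕ) then 1 else 0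
  | [μ], l => if l = μ then 1 else 0
  | μ :: μs, l =>
      ∑' g : {g : ℕ → ℕ // IsPartition g ∧ psize g = (μs.map psize).sum},
        iterLR μs g.1 * LRcoeff l g.1 μ

/-- `D(q, m, B)`: partitions `λ` of `qm` with `c^λ_{μ_1, …, μ_q} > 0` for some
`μ_1, …, μ_q ∈ B` that are not all equal. -/
noncomputable def Dset (q m : ℕ) (B : Set (ℕ → ℕ)) : Set (ℕ → ℕ) :=
  {l ∈ Pset (q * m) | ∃ μ : Fin q → (ℕ → ℕ),
    (∀ i, μ i ∈ B) ∧ (∃ i j, μ i ≠ μ j) ∧ 0 < iterLR (List.ofFn μ) l}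

/-- Iterated `⋆` of a list of sets of partitions. -/
def starAll : List (Set (ℕ → ℕ)) → Set (ℕ → ℕ)
  | [] => Pset 0
  | [A] => A
  | A :: B :: rest => starOp A (starAll (B :: rest))

/-- `Ω(φ(1,0,…,0))` for the Sylow 3-subgroup of `S_{3^k}` (`k ≥ 4`):
`B_{3^k}(2a) ∖ {(2a, a−1, 1), (2a, 2, 1^{a−2}), (2a−1, a+1), (2a−1, 1^{a+1})}°`
where `a = 3^{k−1}`. -/
noncomputable def Cset (k : ℕ) : Set (ℕ → ℕ) :=
  Bset (3 ^ k) (2 * 3 ^ (k - 1)) \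
    conjClosure
      {ofList [2 * 3 ^ (k - 1), 3 ^ (k - 1) - 1, 1],
       ofList (2 * 3 ^ (k - 1) :: 2 :: List.replicate (3 ^ (k - 1) - 2) 1),
       ofList [2 * 3 ^ (k - 1) - 1, 3 ^ (k - 1) + 1],
       hookP (2 * 3 ^ (k - 1) - 1) (3 ^ (k - 1) + 1)}

theorem finite_skewCells {l : ℕ → ℕ} (hl : IsPartition l) (m : ℕ → ℕ) :
    (skewCells l m).Finite := by
  obtain ⟨hanti, N, hN⟩ := hl
  refine ((Set.finite_Iio N).prod (Set.finite_Iio (l 0))).subset ?_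
  rintro ⟨i, j⟩ ⟨-, hj⟩
  have hj' : j < l i := hj
  refine ⟨?_, lt_of_lt_of_le hj' (hanti (Nat.zero_le i))⟩
  by_contra hi
  have := hN i (not_lt.mp hi)
  omega

/-- In an LR filling of a finite set of cells whose weight has at most two parts,
all entries are at most `2`. -/
theorem IsLRFilling.le_two {γ : Set (ℕ × ℕ)} (hγ : γ.Finite) {s t : ℕ} {T : ℕ × ℕ → ℕ}
    (hT : IsLRFilling γ (ofList [s, t]) T) {c : ℕ × ℕ} (hc : c ∈ γ) : T c ≤ 2 := by
  by_contra hlt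
  obtain ⟨k, hk⟩ : ∃ k, T c = k + 3 := ⟨T c - 3, by omega⟩
  have hw := hT.weight (k + 3) (by omega)
  have hzero : ofList [s, t] (k + 3 - 1) = 0 := by simp [ofList]
  rw [hzero, Set.ncard_eq_zero (hγ.subset (Set.sep_subset _ _))] at hw
  have : c ∈ {c ∈ γ | T c = k + 3} := ⟨hc, hk⟩
  simp [hw] at this

/-- Changing to `3` an entry `2` which ends its row, and above which some row contains
another `2`, turns an LR filling of weight `(s, t)` into one of weight `(s, t - 1, 1)`. -/
theorem IsLRFilling.update_three {γ : Set (ℕ × ℕ)} (hγ : γ.Finite) {s t : ℕ}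
    {T : ℕ × ℕ → ℕ} (hT : IsLRFilling γ (ofList [s, t]) T) {c d : ℕ × ℕ}
    (hc : c ∈ γ) (hd : d ∈ γ) (hTc : T c = 2) (hTd : T d = 2) (hcd : c.1 < d.1)
    (hlast : ∀ j, (d.1, j) ∈ γ → j ≤ d.2) :
    IsLRFilling γ (ofList [s, t - 1, 1]) (Function.update T d 3) := by
  have hle : ∀ e ∈ γ, T e ≤ 2 := fun e he => hT.le_two hγ he
  have hne : c ≠ d := fun h => by simp [h] at hcd
  have hd3 : Function.update T d 3 d = 3 := Function.update_self ..
  have hoff : ∀ e, e ≠ d → Function.update T d 3 e = T e :=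
    fun e he => Function.update_of_ne he ..
  generalize Function.update T d 3 = U at hd3 hoff ⊢
  have hone : ∀ e, U e = 1 ↔ T e = 1 := fun e => by
    by_cases he : e = d
    · subst he; omega
    · rw [hoff e he]
  have htwo : ∀ e, U e = 2 ↔ T e = 2 ∧ e ≠ d := fun e => by
    by_cases he : e = d
    · subst he; simp [hd3]
    · simp [hoff e he, he]
  have hthree : ∀ e ∈ γ, (U e = 3 ↔ e = d) := fun e hγe => by
    by_cases he : e = d
    · simp [he, hd3]
    · have := hle e hγe
      rw [hoff e he]
      simp only [he, iff_false]
      omega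
  have hle3 : ∀ e ∈ γ, U e ≤ 3 := fun e hγe => by
    by_cases he : e = d
    · simp [he, hd3]
    · have := hle e hγe
      rw [hoff e he]
      omega
  refine ⟨fun e he => ?_, fun j hj => ?_, fun i j j' hij hij' hjj' => ?_,
    fun i i' j hij hij' hii' => ?_, fun e he j hj => ?_⟩
  · by_cases hed : e = d
    · simp [hed, hd3]
    · rw [hoff e hed]
      exact hT.pos e he
  · obtain rfl | rfl | rfl | hj4 : j = 1 ∨ j = 2 ∨ j = 3 ∨ 4 ≤ j := by omega
    · simpa [hone, ofList] using hT.weight 1 le_rfl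
    · have hset : {e ∈ γ | U e = 2} = {e ∈ γ | T e = 2} \ {d} := by
        ext e
        exact (and_congr_right fun _ => htwo e).trans and_assoc.symm
      have hmem : d ∈ {e ∈ γ | T e = 2} := ⟨hd, hTd⟩
      rw [hset, Set.ncard_sdiff_singleton_of_mem hmem, hT.weight 2 (by omega)]
      simp [ofList]
    · have hset : {e ∈ γ | U e = 3} = {d} := by
        ext e
        constructor
        · rintro ⟨he, h3⟩
          exact (hthree e he).1 h3
        · rintro rfl
          exact ⟨hd, hd3⟩
      rw [hset, Set.ncard_singleton]
      simp [ofList]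
    · have hset : {e ∈ γ | U e = j} = ∅ := by
        ext e
        simp only [Set.mem_ofPred_eq, Set.mem_empty_iff_false, iff_false, not_and]
        intro he h
        have := hle3 e he
        omega
      obtain ⟨k, rfl⟩ : ∃ k, j = k + 4 := ⟨j - 4, by omega⟩
      rw [hset, Set.ncard_empty]
      simp [ofList]
  · by_cases h' : (i, j') = d
    · rw [h', hd3]
      exact hle3 _ hij
    · rw [hoff _ h']
      have hjd : (i, j) ≠ d := by
        rintro rfl
        have := hlast j' hij'
        exact h' (by simp at this; simp; omega)
      rw [hoff _ hjd]
      exact hT.row_weak i j j' hij hij' hjj'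
  · have hlt := hT.col_strict i i' j hij hij' hii'
    have hle' := hle _ hij'
    have h : (i, j) ≠ d := by
      intro h
      rw [h, hTd] at hlt
      omega
    rw [hoff _ h]
    by_cases h' : (i', j) = d
    · rw [h', hd3]
      have := hle _ hij
      omega
    · rwa [hoff _ h']
  · obtain rfl | rfl | hj3 : j = 1 ∨ j = 2 ∨ 3 ≤ j := by omega
    · refine le_trans (Set.ncard_le_ncard ?_ (hγ.subset (Set.sep_subset _ _)))
        ((hT.lattice e he 1 le_rfl).trans (le_of_eq ?_))
      · rintro x ⟨hx, hx2, hxe⟩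
        exact ⟨hx, ((htwo x).1 hx2).1, hxe⟩
      · simp only [hone]
    · by_cases hde : readBefore d e
      · have hce : readBefore c e := by
          unfold readBefore at hde ⊢
          omega
        have hmem : c ∈ {x ∈ γ | U x = 2 ∧ readBefore x e} :=
          ⟨hc, (htwo c).2 ⟨hTc, hne⟩, hce⟩
        calc Set.ncard {x ∈ γ | U x = 2 + 1 ∧ readBefore x e}
            ≤ Set.ncard {d} := Set.ncard_le_ncard
              (fun x hx => (hthree x hx.1).1 hx.2.1) (Set.finite_singleton d)
          _ = Set.ncard {c} := by simp
          _ ≤ _ := Set.ncard_le_ncard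
              (Set.singleton_subset_iff.2 hmem)
              (hγ.subset (Set.sep_subset _ _))
      · have hset : {x ∈ γ | U x = 2 + 1 ∧ readBefore x e} = ∅ := by
          refine Set.eq_empty_of_forall_notMem ?_
          rintro x ⟨hx, hx3, hxe⟩
          rw [(hthree x hx).1 hx3] at hxe
          exact hde hxe
        simp [hset]
    · have hset : {x ∈ γ | U x = j + 1 ∧ readBefore x e} = ∅ := by
        refine Set.eq_empty_of_forall_notMem ?_
        rintro x ⟨hx, hxj, -⟩
        have := hle3 x hx
        omega
      simp [hset]

/-- if `γ = l/m` is a skew shape and `(s, t) ∈ LR(γ)` with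
`s ≥ t ≥ 2`, then either `(s, t−1, 1) ∈ LR(γ)`, or in every LR filling of `γ`
of weight `(s, t)` all `t` entries equal to `2` occur in a single row. -/
theorem lr_tworow_filling (s t : ℕ) (ht : 2 ≤ t) (hst : t ≤ s)
    (l m : ℕ → ℕ) (hl : IsPartition l) (hm : IsPartition m) (hml : ∀ i, m i ≤ l i)
    (h : ofList [s, t] ∈ LRset (skewCells l m)) :
    ofList [s, t - 1, 1] ∈ LRset (skewCells l m) ∨
      ∀ T, IsLRFilling (skewCells l m) (ofList [s, t]) T →
        ∃ r, ∀ c ∈ skewCells l m, T c = 2 → c.1 = r := by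
  have hγ := finite_skewCells hl m
  by_contra! hcon
  obtain ⟨hnot, T, hT, hrows⟩ := hcon
  have key : ∀ c ∈ skewCells l m, ∀ d ∈ skewCells l m, T c = 2 → T d = 2 → ¬ c.1 < d.1 := by
    rintro c hc ⟨r, j⟩ hd hTc hTd hcd
    obtain ⟨hmj, hjl⟩ : m r ≤ j ∧ j < l r := hd
    have hend : (r, l r - 1) ∈ skewCells l m :=
      ⟨show m r ≤ l r - 1 by omega, show l r - 1 < l r by omega⟩
    have hge := hT.row_weak r j (l r - 1) ⟨hmj, hjl⟩ hend (by omega)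
    have hle := hT.le_two hγ hend
    refine hnot ⟨_, hT.update_three hγ hc hend hTc (by omega) hcd ?_⟩
    rintro k ⟨-, hk⟩
    exact Nat.le_sub_one_of_lt hk
  obtain ⟨c, hc, hTc, -⟩ := hrows 0
  obtain ⟨d, hd, hTd, hdc⟩ := hrows c.1
  exact (lt_or_gt_of_ne hdc).elim (key d hd c hc hTd hTc) (key c hc d hd hTc hTd)

end SylowBranching
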